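/- Let i and j be distinct negative half-integers. Every linear map φ : D⁺_i ⊗ D⁻_j → ℂ satisfying φ ∘ (x ⊗ id + id ⊗ x) = 0 for all x ∈ sl(2,ℂ) is zero; i.e. there is no nonzero sl(2,ℂ)-module homomorphism from D⁺_i ⊗ D⁻_j to the trivial module D₀ when i ≠ j. -/

import Mathlib

/-!
Discrete-series weight modules `D⁺_j` and `D⁻_j` of `sl(2,ℂ)`.

`sl(2,ℂ)` is taken to be Mathlib's Lie algebra of traceless `2×2` complex matrices,
with basis `J⁰ = diag(1,-1)`, `J⁺ = E₀₁`, `J⁻ = E₁₀`, so that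
`[J⁺,J⁻] = J⁰`, `[J⁰,J^±] = ±2 J^±`.  A general element
`x` decomposes as `x = x₀₀·J⁰ + x₀₁·J⁺ + x₁₀·J⁻`, and an action of `sl(2,ℂ)` is
specified by the three operators representing `J⁰`, `J⁺`, `J⁻`.

The underlying space of `D^±_j` is the space `ℕ →₀ ℂ` of finitely supported
functions, with standard basis `ket m = |j,m⟩`.
-/

noncomputable section

abbrev Dspace : Type := ℕ →₀ ℂ

/-- the basis vector `|j,m⟩` -/
def ket (m : ℕ) : Dspace := Finsupp.single m 1

/-- diagonal operator `ket m ↦ c m • ket m` -/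
def diagOp (c : ℕ → ℂ) : Dspace →ₗ[ℂ] Dspace :=
  Finsupp.lsum ℂ fun m => c m • Finsupp.lsingle m

/-- raising operator `ket m ↦ c m • ket (m+1)` -/
def raiseOp (c : ℕ → ℂ) : Dspace →ₗ[ℂ] Dspace :=
  Finsupp.lsum ℂ fun m => c m • Finsupp.lsingle (m + 1)

/-- lowering operator `ket m ↦ c m • ket (m-1)` (with `c 0 = 0` in all uses below) -/
def lowerOp (c : ℕ → ℂ) : Dspace →ₗ[ℂ] Dspace :=
  Finsupp.lsum ℂ fun m => c m • Finsupp.lsingle (m - 1)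

/-- `√((m+1)(m−2j))` -/
def aCoeff (j : ℝ) (m : ℕ) : ℂ := (Real.sqrt ((m + 1) * (m - 2 * j)) : ℝ)

/-- `√(m(m−1−2j))` -/
def bCoeff (j : ℝ) (m : ℕ) : ℂ := (Real.sqrt (m * (m - 1 - 2 * j)) : ℝ)

/-- `J⁰` on `D⁺_j`:  `J⁰|j,m⟩ = 2(−j+m)|j,m⟩` -/
def JzP (j : ℝ) : Dspace →ₗ[ℂ] Dspace := diagOp fun m => 2 * (-(j : ℂ) + m)

/-- `J⁺` on `D⁺_j`:  `J⁺|j,m⟩ = √((m+1)(m−2j)) |j,m+1⟩` -/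
def JpP (j : ℝ) : Dspace →ₗ[ℂ] Dspace := raiseOp fun m => aCoeff j m

/-- `J⁻` on `D⁺_j`:  `J⁻|j,m⟩ = −√(m(m−1−2j)) |j,m−1⟩` -/
def JmP (j : ℝ) : Dspace →ₗ[ℂ] Dspace := lowerOp fun m => -bCoeff j m

/-- `J⁰` on `D⁻_j`:  `J⁰|j,m⟩ = 2(j−m)|j,m⟩` -/
def JzM (j : ℝ) : Dspace →ₗ[ℂ] Dspace := diagOp fun m => 2 * ((j : ℂ) - m)

/-- `J⁺` on `D⁻_j`:  `J⁺|j,m⟩ = −√(m(m−1−2j)) |j,m−1⟩` -/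
def JpM (j : ℝ) : Dspace →ₗ[ℂ] Dspace := lowerOp fun m => -bCoeff j m

/-- `J⁻` on `D⁻_j`:  `J⁻|j,m⟩ = √((m+1)(m−2j)) |j,m+1⟩` -/
def JmM (j : ℝ) : Dspace →ₗ[ℂ] Dspace := raiseOp fun m => aCoeff j m

/-- the Lie algebra `sl(2,ℂ)` -/
abbrev sl2 := LieAlgebra.SpecialLinear.sl (Fin 2) ℂ

/-- the action of a general element `x = x₀₀·J⁰ + x₀₁·J⁺ + x₁₀·J⁻` of `sl(2,ℂ)`,
given the operators representing the basis `J⁰, J⁺, J⁻`. -/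
def actOf (Jz Jp Jm : Dspace →ₗ[ℂ] Dspace) (x : sl2) : Dspace →ₗ[ℂ] Dspace :=
  (x : Matrix (Fin 2) (Fin 2) ℂ) 0 0 • Jz + (x : Matrix (Fin 2) (Fin 2) ℂ) 0 1 • Jp +
    (x : Matrix (Fin 2) (Fin 2) ℂ) 1 0 • Jm

/-- the action of `x ∈ sl(2,ℂ)` on `D⁺_j` -/
def actP (j : ℝ) (x : sl2) : Dspace →ₗ[ℂ] Dspace := actOf (JzP j) (JpP j) (JmP j) x

/-- the action of `x ∈ sl(2,ℂ)` on `D⁻_j` -/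
def actM (j : ℝ) (x : sl2) : Dspace →ₗ[ℂ] Dspace := actOf (JzM j) (JpM j) (JmM j) x

/-- the bilinear pairing `β_j` of `D⁺_j` with `D⁻_j`, `β_j(|j,m⟩₊,|j,n⟩₋) = δ_{m,n}` -/
def betaForm : Dspace →ₗ[ℂ] Dspace →ₗ[ℂ] ℂ :=
  Finsupp.lsum ℂ fun m => LinearMap.toSpanSingleton ℂ (Dspace →ₗ[ℂ] ℂ) (Finsupp.lapply m)

open TensorProduct

theorem diagOp_single (c : ℕ → ℂ) (m : ℕ) :
    diagOp c (Finsupp.single m 1) = c m • Finsupp.single m 1 := by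
  simp [diagOp]

theorem raiseOp_single (c : ℕ → ℂ) (m : ℕ) :
    raiseOp c (Finsupp.single m 1) = c m • Finsupp.single (m + 1) 1 := by
  simp [raiseOp]

theorem lowerOp_single (c : ℕ → ℂ) (m : ℕ) :
    lowerOp c (Finsupp.single m 1) = c m • Finsupp.single (m - 1) 1 := by
  simp [lowerOp]

theorem aCoeff_ne_zero (j : ℝ) (hj : j < 0) (m : ℕ) : aCoeff j m ≠ 0 := by
  have h : (0 : ℝ) < (m + 1) * (m - 2 * j) := by
    have : (0 : ℝ) ≤ m := Nat.cast_nonneg m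
    apply mul_pos <;> linarith
  unfold aCoeff
  exact_mod_cast (Real.sqrt_pos.2 h).ne'

theorem bCoeff_zero (j : ℝ) : bCoeff j 0 = 0 := by
  simp [bCoeff]

/-- Let `i` and `j` be distinct negative half-integers.  Every linear
map `φ : D⁺_i ⊗ D⁻_j → ℂ` satisfying `φ ∘ (x ⊗ id + id ⊗ x) = 0` for all
`x ∈ sl(2,ℂ)` is zero; i.e. there is no nonzero `sl(2,ℂ)`-module homomorphism from
`D⁺_i ⊗ D⁻_j` to the trivial module `D₀` when `i ≠ j`. -/
theorem statement3 (i j : ℝ)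
    (hihalf : ∃ n : ℤ, (n : ℝ) = 2 * i) (hineg : i < 0)
    (hjhalf : ∃ n : ℤ, (n : ℝ) = 2 * j) (hjneg : j < 0)
    (hne : i ≠ j)
    (φ : (Dspace ⊗[ℂ] Dspace) →ₗ[ℂ] ℂ)
    (hφ : ∀ x : sl2,
      φ ∘ₗ (TensorProduct.map (actP i x) LinearMap.id
        + TensorProduct.map LinearMap.id (actM j x)) = 0) :
    φ = 0 := by
  have key : ∀ (x : sl2) (m n : ℕ),
      φ (actP i x (Finsupp.single m 1) ⊗ₜ Finsupp.single n 1) +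
        φ (Finsupp.single m 1 ⊗ₜ actM j x (Finsupp.single n 1)) = 0 := by
    intro x m n
    have := LinearMap.congr_fun (hφ x) (Finsupp.single m 1 ⊗ₜ Finsupp.single n 1)
    simpa using this
  set f : ℕ → ℕ → ℂ := fun m n =>
    φ ((Finsupp.single m 1 : Dspace) ⊗ₜ[ℂ] (Finsupp.single n 1 : Dspace)) with hf
  have h0 : ∀ m n, 2 * (-(i : ℂ) + m) * f m n + 2 * ((j : ℂ) - n) * f m n = 0 := by
    intro m n
    have := key ⟨!![1, 0; 0, -1], by simp [LieAlgebra.SpecialLinear.sl, Matrix.trace]⟩ m n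
    simpa [actP, actM, actOf, JzP, JzM, diagOp_single, ← TensorProduct.smul_tmul', TensorProduct.tmul_smul, hf,
      -Finsupp.smul_single, -neg_smul] using this
  have hp : ∀ m n, aCoeff i m * f (m + 1) n + -bCoeff j n * f m (n - 1) = 0 := by
    intro m n
    have := key ⟨!![0, 1; 0, 0], by simp [LieAlgebra.SpecialLinear.sl, Matrix.trace]⟩ m n
    simp only [actP, actM, actOf, JpP, JpM] at this
    simpa [raiseOp_single, lowerOp_single, ← TensorProduct.smul_tmul', TensorProduct.tmul_smul, hf,
      -Finsupp.smul_single, -neg_smul] using this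
  have hm : ∀ m n, -bCoeff i m * f (m - 1) n + aCoeff j n * f m (n + 1) = 0 := by
    intro m n
    have := key ⟨!![0, 0; 1, 0], by simp [LieAlgebra.SpecialLinear.sl, Matrix.trace]⟩ m n
    simp only [actP, actM, actOf, JmP, JmM] at this
    simpa [raiseOp_single, lowerOp_single, ← TensorProduct.smul_tmul', TensorProduct.tmul_smul, hf,
      -Finsupp.smul_single, -neg_smul] using this
  have hz : ∀ m n, f m n = 0 := by
    intro m
    induction m with
    | zero =>
      intro n
      cases n with
      | zero =>
        have h := h0 0 0
        have hij : (j : ℂ) - i ≠ 0 := by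
          rw [sub_ne_zero]; exact_mod_cast hne.symm
        have h2 : ((j : ℂ) - i) * f 0 0 = 0 := by
          push_cast at h
          linear_combination h / 2
        exact (mul_eq_zero.1 h2).resolve_left hij
      | succ n =>
        have h := hm 0 n
        rw [bCoeff_zero, neg_zero, zero_mul, zero_add] at h
        exact (mul_eq_zero.1 h).resolve_left (aCoeff_ne_zero j hjneg n)
    | succ m ih =>
      intro n
      have h := hp m n
      rw [ih, mul_zero, add_zero] at h
      exact (mul_eq_zero.1 h).resolve_left (aCoeff_ne_zero i hineg m)
  ext m n
  simpa [hf] using hz m n
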